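/- Non-Archimedean Mean Value Theorem: let a ∈ ℂ_p, r > 0, and let (a_n)_{n≥0} be a sequence in ℂ_p such that for every z ∈ ℂ_p with |z − a| < r the series f(z) := ∑_{n≥0} a_n (z − a)^n converges. Then for all z, w ∈ ℂ_p with |z − a| < r, |w − a| < r and |z − w| < ϱ·r, there exists u ∈ ℂ_p with |u − a| < r such that |f(z) − f(w)| = |f'(u)|·|z − w|, where f'(u) := ∑_{n≥1} n·a_n·(u − a)^{n−1}. -/

import Mathlib

noncomputable section

/-- `K` is a model of `ℂ_p`, the completion of an algebraic closure of `ℚ_p`: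
it is a complete, algebraically closed, nonarchimedean normed field whose norm
extends the `p`-adic absolute value and in which the algebraic elements over
`ℚ_p` are dense. -/
structure IsCp (p : ℕ) [Fact p.Prime] (K : Type*) [NormedField K] [Algebra ℚ_[p] K] : Prop where
  complete : CompleteSpace K
  norm_extends : ∀ x : ℚ_[p], ‖algebraMap ℚ_[p] K x‖ = ‖x‖
  isAlgClosed : IsAlgClosed K
  dense_algebraic : Dense {x : K | IsAlgebraic ℚ_[p] x}
  isNonarch : ∀ x y : K, ‖x + y‖ ≤ max ‖x‖ ‖y‖

/-- `ϱ = p^{-1/(p-1)}`. -/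
def rho (p : ℕ) : ℝ := (p : ℝ) ^ (-1 / ((p : ℝ) - 1))

/-- `R` is a sequence of radii: strictly increasing (for indices `≥ 1`),
with `R 1 > p`, tending to infinity. -/
def IsRadii (p : ℕ) (R : ℕ → ℝ) : Prop :=
  (∀ j, 1 ≤ j → R j < R (j + 1)) ∧ (p : ℝ) < R 1 ∧
    Filter.Tendsto R Filter.atTop Filter.atTop

/-- The piecewise-monomial map `φ`: for `R_{j-1} < t ≤ R_j` (with `R_0 := 0`),
`φ(t) = p (R_1 ⋯ R_{j-1})⁻¹ t^{p+j-1}`. -/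
def phi (p : ℕ) (R : ℕ → ℝ) (t : ℝ) : ℝ :=
  let j := sInf {j : ℕ | 1 ≤ j ∧ t ≤ R j}
  (p : ℝ) * (∏ i ∈ Finset.Icc 1 (j - 1), R i)⁻¹ * t ^ (p + j - 1)

/-- A generic sequence of radii. -/
def IsGenericRadii (p : ℕ) (R : ℕ → ℝ) : Prop :=
  IsRadii p R ∧ ∀ i j n : ℕ, 1 ≤ i → i < j → 1 ≤ n → (phi p R)^[n] (R i) ≠ R j

/-- Membership in the parameter space `C(r)`: `|c_j| = R_j` for all `j ≥ 1`. -/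
def InC (p : ℕ) [Fact p.Prime] {K : Type*} [NormedField K] (R : ℕ → ℝ) (c : ℕ → K) : Prop :=
  ∀ j, 1 ≤ j → ‖c j‖ = R j

/-- The transcendental entire map `f_c(z) = (z^p/p) ∏_{j ≥ 1} (1 - z/c_j)`. -/
def fc (p : ℕ) {K : Type*} [NormedField K] (c : ℕ → K) (z : K) : K :=
  z ^ p / (p : K) * ∏' j : ℕ, (1 - z / c (j + 1))

/-- The disk `B_0 = {|z| < 1}` for `j = 0`, and `B_j = {|z - c_j| < R_j}` for `j ≥ 1`. -/
def Bset {K : Type*} [NormedField K] (R : ℕ → ℝ) (c : ℕ → K) (j : ℕ) : Set K :=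
  if j = 0 then {z : K | ‖z‖ < 1} else {z : K | ‖z - c j‖ < R j}

/-- The set `A`, complement of all the disks `B_j`, `j ≥ 0`. -/
def Aset {K : Type*} [NormedField K] (R : ℕ → ℝ) (c : ℕ → K) : Set K :=
  (⋃ j, Bset R c j)ᶜ

/-- `n_j`, the minimal `n ≥ 1` with `R_j < φ^{∘(n+1)}(1)`. -/
def nseq (p : ℕ) (R : ℕ → ℝ) (j : ℕ) : ℕ :=
  sInf {n : ℕ | 1 ≤ n ∧ R j < (phi p R)^[n + 1] 1}

/-- `S_j = φ⁻¹(R_j)`. -/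
def Sse (p : ℕ) (R : ℕ → ℝ) (j : ℕ) : ℝ := Function.invFun (phi p R) (R j)

/-- `λ_j = φ(R_j)/R_j`. -/
def lam (p : ℕ) (R : ℕ → ℝ) (j : ℕ) : ℝ := phi p R (R j) / R j

/-- `L_k`: index of the first symbol of the `k`-th block `B_0^{m_k} A^{n_k} B_k^{…}`
of the itinerary `α(m, ℓ)`; `L_1 = 0` and `L_{k+1} = L_k + m_k + n_k + ℓ_{k+1}`. -/
def Lseq (m n l : ℕ → ℕ) : ℕ → ℕ
  | 0 => 0
  | 1 => 0
  | k + 2 => Lseq m n l (k + 1) + m (k + 1) + n (k + 1) + l (k + 2)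

/-- `N_k = L_k + m_k + n_k`, the index of the final symbol `B_k` of the truncated
itinerary `α^{(k)}` (so `α^{(k)}` has length `N_k + 1`). -/
def Nseq (m n l : ℕ → ℕ) (k : ℕ) : ℕ := Lseq m n l k + m k + n k

/-- The symbol (`some 0 = B_0`, `none = A`, `some k = B_k`) at position `i` of the
itinerary `α(m,ℓ) = B_0^{m_1} A^{n_1} B_1^{ℓ_2} B_0^{m_2} A^{n_2} B_2^{ℓ_3} ⋯`. -/
def itin (m n l : ℕ → ℕ) (i : ℕ) : Option ℕ :=
  let k := sSup {k : ℕ | 1 ≤ k ∧ Lseq m n l k ≤ i}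
  if i < Lseq m n l k + m k then some 0
  else if i < Lseq m n l k + m k + n k then none
  else some k

/-- The subset of `ℂ_p` corresponding to a symbol of the alphabet `{A, B_0, B_1, …}`. -/
def symbSet {K : Type*} [NormedField K] (R : ℕ → ℝ) (c : ℕ → K) : Option ℕ → Set K
  | none => Aset R c
  | some j => Bset R c j

/-- Condition (3.2) at `k`: `ϱ⁻¹ R_k p^{-m_k} λ_k^{ℓ_{k+1}} < 1`. -/
def Cond32 (p : ℕ) (R : ℕ → ℝ) (m l : ℕ → ℕ) (k : ℕ) : Prop :=
  (rho p)⁻¹ * R k * ((p : ℝ) ^ m k)⁻¹ * lam p R k ^ l (k + 1) < 1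

/-- Condition (3.3) for `k`: for all `2 ≤ j < k`,
`ε_k < ϱ^{k-j} R_k² (R_{j-1} S_{j-1})⁻¹ λ_{j-1}^{-ℓ_j}`. -/
def Cond33 (p : ℕ) (R : ℕ → ℝ) (ε : ℕ → ℝ) (l : ℕ → ℕ) (k : ℕ) : Prop :=
  ∀ j, 2 ≤ j → j < k →
    ε k < rho p ^ (k - j) * R k ^ 2 * (R (j - 1) * Sse p R (j - 1))⁻¹ *
      (lam p R (j - 1) ^ l j)⁻¹

/-- Condition (3.4) for `k`: for all `2 ≤ j ≤ k`,
`ϱ^{-2} R_{j-1} S_{j-1} λ_{j-1}^{ℓ_j} p^{-m_j} < 1`. -/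
def Cond34 (p : ℕ) (R : ℕ → ℝ) (m l : ℕ → ℕ) (k : ℕ) : Prop :=
  ∀ j, 2 ≤ j → j ≤ k →
    ((rho p) ^ 2)⁻¹ * (R (j - 1) * Sse p R (j - 1)) * lam p R (j - 1) ^ l j *
      ((p : ℝ) ^ m j)⁻¹ < 1

/-- Condition (3.5) at `k`: `p ϱ⁻¹ R_{k+1}² S_k⁻¹ λ_k^{-ℓ_{k+1}} < ε_{k+1}`. -/
def Cond35 (p : ℕ) (R : ℕ → ℝ) (ε : ℕ → ℝ) (l : ℕ → ℕ) (k : ℕ) : Prop :=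
  (p : ℝ) * (rho p)⁻¹ * R (k + 1) ^ 2 * (Sse p R k)⁻¹ * (lam p R k ^ l (k + 1))⁻¹ < ε (k + 1)

/-- `c' ∈ Δ_k(c, ε)`. -/
def InDelta (p : ℕ) [Fact p.Prime] {K : Type*} [NormedField K] (R : ℕ → ℝ) (c : ℕ → K)
    (ε : ℕ → ℝ) (k : ℕ) (c' : ℕ → K) : Prop :=
  InC p R c' ∧ (∀ j, 1 ≤ j → j < k → c' j = c j) ∧ ∀ j, k ≤ j → ‖c' j - c j‖ < ε j

/-- `c' ∈ U_k(c, ε)`. -/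
def InU (p : ℕ) [Fact p.Prime] {K : Type*} [NormedField K] (R : ℕ → ℝ) (c : ℕ → K)
    (k : ℕ) (ε : ℝ) (c' : ℕ → K) : Prop :=
  InC p R c' ∧ ‖c' k - c k‖ < ε ∧ ∀ j, 1 ≤ j → j ≠ k → c' j = c j

open Filter Topology Polynomial

/-- The value group of an algebraically closed nontrivially normed field is dense. -/
theorem exists_norm_mem_Ioo {K : Type*} [NontriviallyNormedField K] [IsAlgClosed K] {s r : ℝ}
    (hs : 0 < s) (hsr : s < r) : ∃ x : K, s < ‖x‖ ∧ ‖x‖ < r := by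
  obtain ⟨g, hg⟩ := NormedField.exists_one_lt_norm K
  have h1 : 1 < r / s := (one_lt_div hs).2 hsr
  obtain ⟨n, hn⟩ := pow_unbounded_of_one_lt ‖g‖ h1
  have hn0 : n ≠ 0 := by
    rintro rfl
    exact hn.not_gt (by simpa using hg)
  obtain ⟨m, hm1, hm2⟩ := exists_mem_Ico_zpow (pow_pos hs n) hg
  obtain ⟨x, hx⟩ := IsAlgClosed.exists_pow_nat_eq (g ^ (m + 1)) (Nat.pos_of_ne_zero hn0)
  have hxn : ‖x‖ ^ n = ‖g‖ ^ (m + 1) := by rw [← norm_pow, hx, norm_zpow]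
  refine ⟨x, lt_of_pow_lt_pow_left₀ n (norm_nonneg x) (hxn ▸ hm2),
    lt_of_pow_lt_pow_left₀ n (hs.trans hsr).le ?_⟩
  have hg0 : 0 < ‖g‖ := by linarith
  rw [hxn, zpow_add_one₀ hg0.ne']
  rw [div_pow, lt_div_iff₀ (pow_pos hs n)] at hn
  calc ‖g‖ ^ m * ‖g‖ ≤ s ^ n * ‖g‖ := by gcongr
    _ < r ^ n := by linarith

theorem padicValNat_mul_pred_add_one_le (p : ℕ) [Fact p.Prime] {k : ℕ} (hk : k ≠ 0) :
    padicValNat p k * (p - 1) + 1 ≤ k := by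
  have hp := (Fact.out : p.Prime).two_le
  have h1 : p ^ padicValNat p k ≤ k := Nat.le_of_dvd (Nat.pos_of_ne_zero hk) pow_padicValNat_dvd
  obtain ⟨q, rfl⟩ : ∃ q, p = 1 + q := ⟨p - 1, by omega⟩
  have h2 := one_add_mul_le_pow_of_sq_nonneg (a := q) (by positivity) (by positivity) (by positivity)
    (padicValNat (1 + q) k)
  simp only [Nat.cast_id] at h2
  simp only [Nat.add_sub_cancel_left]
  omega

theorem rho_pos (p : ℕ) [Fact p.Prime] : 0 < rho p :=
  Real.rpow_pos_of_pos (by exact_mod_cast (Fact.out : p.Prime).pos) _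

theorem rho_pow_le_norm_natCast (p : ℕ) [Fact p.Prime] {k : ℕ} (hk : k ≠ 0) :
    rho p ^ (k - 1) ≤ ‖(k : ℚ_[p])‖ := by
  have hp : (1 : ℝ) < p := by exact_mod_cast (Fact.out : p.Prime).one_lt
  have hv : ((padicValNat p k : ℝ) * (p - 1) + 1) ≤ k := by
    have := padicValNat_mul_pred_add_one_le p hk
    rw [← Nat.cast_le (α := ℝ)] at this
    push_cast [Nat.cast_sub (Fact.out : p.Prime).one_le] at this
    exact this
  rw [Padic.norm_eq_zpow_neg_valuation (by exact_mod_cast hk), Padic.valuation_natCast,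
    ← Real.rpow_intCast, rho, ← Real.rpow_natCast, ← Real.rpow_mul (by linarith)]
  refine Real.rpow_le_rpow_of_exponent_le hp.le ?_
  rw [Nat.cast_sub (Nat.one_le_iff_ne_zero.2 hk), Nat.cast_one, Int.cast_neg, Int.cast_natCast]
  rw [div_mul_eq_mul_div, div_le_iff₀ (by linarith)]
  linarith

/-- A nonnegative sequence tending to zero attains its maximum. -/
theorem exists_forall_le_of_tendsto_zero {u : ℕ → ℝ} (hu0 : ∀ n, 0 ≤ u n)
    (hu : Tendsto u atTop (𝓝 0)) : ∃ m, ∀ n, u n ≤ u m := by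
  by_cases h : ∀ n, u n ≤ 0
  · exact ⟨0, fun n ↦ (h n).trans (hu0 0)⟩
  push Not at h
  obtain ⟨k, hk⟩ := h
  obtain ⟨N, hN⟩ := eventually_atTop.1 (hu.eventually_lt_const hk)
  obtain ⟨m, -, hm⟩ := (Finset.range (max N k + 1)).exists_max_image u ⟨0, by simp⟩
  refine ⟨m, fun n ↦ ?_⟩
  rcases lt_or_ge n N with h | h
  · exact hm n (by simp; omega)
  · exact (hN n h).le.trans (hm k (by simp))

theorem tendsto_update_mul_pow {K : Type*} [NormedField K] {c : ℕ → K} {t : ℝ}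
    (hc : Tendsto (fun n ↦ ‖c n‖ * t ^ n) atTop (𝓝 0)) (i : ℕ) (v : K) :
    Tendsto (fun n ↦ ‖Function.update c i v n‖ * t ^ n) atTop (𝓝 0) := by
  refine hc.congr' ?_
  filter_upwards [eventually_gt_atTop i] with n hn
  rw [Function.update_of_ne hn.ne']

section Ultrametric

variable {K : Type*} [NontriviallyNormedField K] [IsUltrametricDist K]

theorem norm_sub_le_max_norm (x y : K) : ‖x - y‖ ≤ max ‖x‖ ‖y‖ := by
  simpa [sub_eq_add_neg] using IsUltrametricDist.norm_add_le_max x (-y)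

/-- Binomial coefficients satisfy `|C(n, k)| |k| ≤ |n|` in an ultrametric field. -/
theorem norm_choose_mul_norm_le (n k : ℕ) :
    ‖((n + 1).choose (k + 1) : K)‖ * ‖((k + 1 : ℕ) : K)‖ ≤ ‖((n + 1 : ℕ) : K)‖ := by
  rw [← norm_mul, ← Nat.cast_mul, ← Nat.add_one_mul_choose_eq, Nat.cast_mul, norm_mul]
  exact mul_le_of_le_one_right (norm_nonneg _) (IsUltrametricDist.norm_natCast_le_one K _)

theorem norm_add_pow_sub_pow_le {ρ t : ℝ} (hρ : ∀ k : ℕ, k ≠ 0 → ρ ^ (k - 1) ≤ ‖(k : K)‖)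
    (hρ0 : 0 < ρ) {y h : K} (hy : ‖y‖ ≤ t) (hh : ‖h‖ ≤ ρ * t) (n : ℕ) :
    ‖(h + y) ^ (n + 1) - y ^ (n + 1)‖ ≤ ‖((n + 1 : ℕ) : K)‖ * t ^ n * ‖h‖ := by
  have ht : 0 ≤ t := (norm_nonneg y).trans hy
  rw [add_pow, Finset.sum_range_succ']
  simp only [pow_zero, one_mul, Nat.sub_zero, Nat.choose_zero_right, Nat.cast_one, mul_one,
    add_sub_cancel_right]
  refine IsUltrametricDist.norm_sum_le_of_forall_le_of_nonneg (by positivity) fun k hk ↦ ?_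
  have hkn : k ≤ n := by simpa [Nat.lt_succ_iff] using hk
  have e : n + 1 - (k + 1) = n - k := by omega
  rw [norm_mul, norm_mul, norm_pow, norm_pow, e]
  have hk1 : ρ ^ k ≤ ‖((k + 1 : ℕ) : K)‖ := by simpa using hρ (k + 1) (by omega)
  calc ‖h‖ ^ (k + 1) * ‖y‖ ^ (n - k) * ‖((n + 1).choose (k + 1) : K)‖
      ≤ ((ρ * t) ^ k * ‖h‖) * t ^ (n - k) * ‖((n + 1).choose (k + 1) : K)‖ := by
        rw [pow_succ]; gcongr
    _ = (‖((n + 1).choose (k + 1) : K)‖ * ρ ^ k) * (t ^ k * t ^ (n - k)) * ‖h‖ := by ring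
    _ ≤ (‖((n + 1).choose (k + 1) : K)‖ * ‖((k + 1 : ℕ) : K)‖) * (t ^ k * t ^ (n - k)) * ‖h‖ := by
        gcongr
    _ ≤ ‖((n + 1 : ℕ) : K)‖ * (t ^ k * t ^ (n - k)) * ‖h‖ := by
        gcongr
        exact norm_choose_mul_norm_le n k
    _ = ‖((n + 1 : ℕ) : K)‖ * t ^ n * ‖h‖ := by
        rw [← pow_add, Nat.add_sub_cancel' hkn]

theorem norm_coeff_prod_X_sub_C {δ : ℝ} (hδ : 0 ≤ δ) (s : Multiset K) (hs : ∀ ξ ∈ s, δ < ‖ξ‖) :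
    (s.map fun ξ ↦ X - C ξ).prod.coeff 0 ≠ 0 ∧ ∀ j, j ≠ 0 →
      ‖(s.map fun ξ ↦ X - C ξ).prod.coeff j‖ * δ ^ j <
        ‖(s.map fun ξ ↦ X - C ξ).prod.coeff 0‖ := by
  induction s using Multiset.induction_on with
  | empty => simp +contextual [Polynomial.coeff_one]
  | cons ξ s ih =>
    obtain ⟨ih0, ih⟩ := ih fun η hη ↦ hs η (Multiset.mem_cons_of_mem hη)
    have hξ := hs ξ (Multiset.mem_cons_self ξ s)
    have hξ0 : 0 < ‖ξ‖ := hδ.trans_lt hξ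
    simp only [Multiset.map_cons, Multiset.prod_cons]
    generalize (s.map fun ξ ↦ X - C ξ).prod = Q at ih0 ih
    have hQ0 : 0 < ‖Q.coeff 0‖ := norm_pos_iff.2 ih0
    have e0 : ((X - C ξ) * Q).coeff 0 = -(ξ * Q.coeff 0) := by simp [sub_mul]
    refine ⟨by rw [e0]; simpa [ih0] using norm_pos_iff.1 hξ0, fun j hj ↦ ?_⟩
    obtain ⟨i, rfl⟩ := Nat.exists_eq_succ_of_ne_zero hj
    have e1 : ((X - C ξ) * Q).coeff (i + 1) = Q.coeff i - ξ * Q.coeff (i + 1) := by simp [sub_mul]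
    rw [e0, Nat.succ_eq_add_one, e1, norm_neg, norm_mul]
    have hi : ‖Q.coeff i‖ * δ ^ i ≤ ‖Q.coeff 0‖ := by
      rcases eq_or_ne i 0 with rfl | h
      · simp
      · exact (ih i h).le
    refine (mul_le_mul_of_nonneg_right (norm_sub_le_max_norm _ _) (by positivity)).trans_lt ?_
    rw [max_mul_of_nonneg _ _ (by positivity), max_lt_iff]
    constructor
    · calc ‖Q.coeff i‖ * δ ^ (i + 1) = δ * (‖Q.coeff i‖ * δ ^ i) := by ring
        _ ≤ δ * ‖Q.coeff 0‖ := by gcongr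
        _ < ‖ξ‖ * ‖Q.coeff 0‖ := by gcongr
    · rw [norm_mul, mul_assoc]
      exact mul_lt_mul_of_pos_left (ih (i + 1) hj) hξ0

/-- A polynomial whose constant term does not dominate on the disk of radius `δ` has a root
in that disk. -/
theorem exists_root_norm_le [IsAlgClosed K] {P : K[X]} {δ : ℝ} (hδ : 0 ≤ δ) {d : ℕ} (hd : d ≠ 0)
    (h : ‖P.coeff 0‖ ≤ ‖P.coeff d‖ * δ ^ d) : ∃ x : K, ‖x‖ ≤ δ ∧ P.eval x = 0 := by
  rcases eq_or_ne P 0 with rfl | hP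
  · exact ⟨0, by simpa using hδ, by simp⟩
  by_contra! hcon
  have hs : ∀ ξ ∈ P.roots, δ < ‖ξ‖ := fun ξ hξ ↦ by
    by_contra! hle
    exact hcon ξ hle (isRoot_of_mem_roots hξ)
  have hlt := (norm_coeff_prod_X_sub_C hδ P.roots hs).2 d hd
  rw [(IsAlgClosed.splits P).eq_prod_roots, coeff_C_mul, coeff_C_mul, norm_mul, norm_mul,
    mul_assoc] at h
  exact (le_of_mul_le_mul_left h (norm_pos_iff.2 (leadingCoeff_ne_zero.2 hP))).not_gt hlt

theorem norm_coeff_le_norm_taylor_coeff {P : K[X]} {t : ℝ} (ht : 0 < t) {d : ℕ}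
    (h : ∀ j, d < j → ‖P.coeff j‖ * t ^ j < ‖P.coeff d‖ * t ^ d) {x : K} (hx : ‖x‖ ≤ t) :
    ‖P.coeff d‖ ≤ ‖(taylor x P).coeff d‖ := by
  by_contra! hcon
  have hpos : 0 < ‖P.coeff d‖ := (norm_nonneg _).trans_lt hcon
  have hsum : (taylor x P).coeff d = P.coeff d +
      ∑ i ∈ Finset.range (hasseDeriv d P).natDegree,
        ((i + 1 + d).choose d : K) * P.coeff (i + 1 + d) * x ^ (i + 1) := by
    rw [taylor_coeff, eval_eq_sum_range, Finset.sum_range_succ', add_comm]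
    simp [hasseDeriv_coeff]
  have hlt : ‖∑ i ∈ Finset.range (hasseDeriv d P).natDegree,
        ((i + 1 + d).choose d : K) * P.coeff (i + 1 + d) * x ^ (i + 1)‖ < ‖P.coeff d‖ := by
    rcases (Finset.range (hasseDeriv d P).natDegree).eq_empty_or_nonempty with he | hne
    · simpa [he] using hpos
    obtain ⟨i, -, hi⟩ := IsUltrametricDist.exists_norm_finsetSum_le_of_nonempty hne
      (fun i ↦ ((i + 1 + d).choose d : K) * P.coeff (i + 1 + d) * x ^ (i + 1))
    refine hi.trans_lt ?_
    rw [norm_mul, norm_mul, norm_pow]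
    calc _ ≤ 1 * ‖P.coeff (i + 1 + d)‖ * t ^ (i + 1) := by
          gcongr
          exact IsUltrametricDist.norm_natCast_le_one K _
      _ < ‖P.coeff d‖ := by
          have := h (i + 1 + d) (by omega)
          rw [pow_add, ← mul_assoc] at this
          rw [one_mul]
          exact lt_of_mul_lt_mul_right this (by positivity)
  have := norm_sub_le_max_norm ((taylor x P).coeff d) (∑ i ∈ Finset.range (hasseDeriv d P).natDegree,
        ((i + 1 + d).choose d : K) * P.coeff (i + 1 + d) * x ^ (i + 1))
  rw [hsum, add_sub_cancel_right, ← hsum] at this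
  exact this.not_gt (max_lt hcon hlt)

section PowerSeries

variable [CompleteSpace K] {c : ℕ → K} {t : ℝ}

theorem summable_mul_pow (hc : Tendsto (fun n ↦ ‖c n‖ * t ^ n) atTop (𝓝 0)) {x : K}
    (hx : ‖x‖ ≤ t) : Summable fun n ↦ c n * x ^ n := by
  refine NonarchimedeanAddGroup.summable_of_tendsto_cofinite_zero ?_
  rw [Nat.cofinite_eq_atTop]
  refine squeeze_zero_norm (fun n ↦ ?_) hc
  rw [norm_mul, norm_pow]
  gcongr

theorem exists_norm_tsum_sub_tsum_le (ht : 0 < t)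
    (hc : Tendsto (fun n ↦ ‖c n‖ * t ^ n) atTop (𝓝 0)) :
    ∃ B : ℝ, ∀ x y : K, ‖x‖ ≤ t → ‖y‖ ≤ t →
      ‖(∑' n, c n * x ^ n) - ∑' n, c n * y ^ n‖ ≤ B * ‖x - y‖ := by
  obtain ⟨B, hB⟩ := hc.bddAbove_range
  have hB' (n : ℕ) : ‖c n‖ * t ^ n ≤ B := hB ⟨n, rfl⟩
  have hB0 : 0 ≤ B := (by positivity : 0 ≤ ‖c 0‖ * t ^ 0).trans (hB' 0)
  refine ⟨B / t, fun x y hx hy ↦ ?_⟩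
  rw [← (summable_mul_pow hc hx).tsum_sub (summable_mul_pow hc hy)]
  refine IsUltrametricDist.norm_tsum_le_of_forall_le_of_nonneg (by positivity) fun n ↦ ?_
  rw [← mul_sub, ← geom_sum₂_mul, norm_mul, norm_mul, ← mul_assoc]
  gcongr
  rcases n with _ | n
  · simp; positivity
  rw [le_div_iff₀ ht]
  refine le_trans ?_ (hB' (n + 1))
  rw [mul_assoc, pow_succ]
  gcongr
  refine IsUltrametricDist.norm_sum_le_of_forall_le_of_nonneg (by positivity) fun i hi ↦ ?_
  rw [norm_mul, norm_pow, norm_pow]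
  have : i + (n + 1 - 1 - i) = n := by simp at hi; omega
  calc ‖x‖ ^ i * ‖y‖ ^ (n + 1 - 1 - i) ≤ t ^ i * t ^ (n + 1 - 1 - i) := by gcongr
    _ = t ^ n := by rw [← pow_add, this]

theorem exists_norm_sub_le_norm_tsum_le [IsAlgClosed K] (ht : 0 < t)
    (hc : Tendsto (fun n ↦ ‖c n‖ * t ^ n) atTop (𝓝 0)) {d : ℕ} (hd : d ≠ 0) (hcd : c d ≠ 0)
    (h : ∀ j, d < j → ‖c j‖ * t ^ j < ‖c d‖ * t ^ d) {x : K} (hx : ‖x‖ ≤ t) {e e' : ℝ}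
    (he' : 0 < e') (hee' : e' ≤ e) (hxe : ‖∑' n, c n * x ^ n‖ ≤ ‖c d‖ * t ^ d * e ^ d) :
    ∃ y : K, ‖y - x‖ ≤ t * e ∧
      (‖y‖ ≤ t → ‖∑' n, c n * y ^ n‖ ≤ ‖c d‖ * t ^ d * e' ^ d) := by
  have hM : 0 < ‖c d‖ * t ^ d * e' ^ d := by have := norm_pos_iff.2 hcd; positivity
  obtain ⟨N, hN⟩ := eventually_atTop.1 (hc.eventually_le_const hM)
  set m := max N (d + 1)
  set P : K[X] := ∑ i ∈ Finset.range m, C (c i) * X ^ i with hP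
  have hcoeff (j : ℕ) : P.coeff j = if j < m then c j else 0 := by
    simp [hP, coeff_X_pow]
  have heval (y : K) : P.eval y = ∑ i ∈ Finset.range m, c i * y ^ i := by
    simp [hP, eval_finsetSum]
  have htail (y : K) (hy : ‖y‖ ≤ t) :
      ‖(∑' n, c n * y ^ n) - P.eval y‖ ≤ ‖c d‖ * t ^ d * e' ^ d := by
    rw [heval, ← (summable_mul_pow hc hy).sum_add_tsum_nat_add m, add_sub_cancel_left]
    refine IsUltrametricDist.norm_tsum_le_of_forall_le_of_nonneg hM.le fun n ↦ ?_
    refine le_trans ?_ (hN (n + m) (by omega))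
    rw [norm_mul, norm_pow]
    gcongr
  have hPd : P.coeff d = c d := by rw [hcoeff, if_pos (by omega)]
  have hPj : ∀ j, d < j → ‖P.coeff j‖ * t ^ j < ‖P.coeff d‖ * t ^ d := fun j hj ↦ by
    rw [hPd, hcoeff]
    split_ifs
    · exact h j hj
    · have := norm_pos_iff.2 hcd
      simp only [norm_zero, zero_mul]
      positivity
  have hT := norm_coeff_le_norm_taylor_coeff ht hPj hx
  have he : 0 ≤ e := he'.le.trans hee'
  have hPx : ‖P.eval x‖ ≤ ‖c d‖ * t ^ d * e ^ d := by
    have h1 := norm_sub_le_max_norm (∑' n, c n * x ^ n) ((∑' n, c n * x ^ n) - P.eval x)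
    rw [sub_sub_cancel] at h1
    refine h1.trans (max_le hxe ((htail x hx).trans ?_))
    gcongr
  obtain ⟨z, hz, hz0⟩ := exists_root_norm_le (P := taylor x P) (δ := t * e) (by positivity) hd (by
    rw [taylor_coeff_zero]
    refine hPx.trans ?_
    rw [mul_pow, ← mul_assoc]
    rw [hPd] at hT
    gcongr)
  rw [taylor_eval] at hz0
  refine ⟨z + x, by simpa using hz, fun hy ↦ ?_⟩
  simpa [hz0] using htail _ hy

/-- A convergent power series whose constant term does not dominate on the closed disk of
radius `t` has a zero in that disk. -/
theorem exists_tsum_eq_zero [IsAlgClosed K] (ht : 0 < t)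
    (hc : Tendsto (fun n ↦ ‖c n‖ * t ^ n) atTop (𝓝 0)) {n : ℕ} (hn : n ≠ 0)
    (h0 : ‖c 0‖ ≤ ‖c n‖ * t ^ n) : ∃ x : K, ‖x‖ ≤ t ∧ ∑' k, c k * x ^ k = 0 := by
  have hF0 : ∑' k, c k * (0 : K) ^ k = c 0 := by
    rw [tsum_eq_single 0 fun k hk ↦ by simp [hk]]
    simp
  rcases eq_or_ne (c 0) 0 with hc0 | hc0
  · exact ⟨0, by simpa using ht.le, by rw [hF0, hc0]⟩
  have hpos : 0 < ‖c n‖ * t ^ n := (norm_pos_iff.2 hc0).trans_le h0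
  obtain ⟨N, hN⟩ := eventually_atTop.1 (hc.eventually_lt_const hpos)
  obtain ⟨d, hnd, hdn, hdmax⟩ : ∃ d, n ≤ d ∧ ‖c n‖ * t ^ n ≤ ‖c d‖ * t ^ d ∧
      ∀ j, d < j → ‖c j‖ * t ^ j < ‖c d‖ * t ^ d := by
    have hbdd : BddAbove {j | ‖c n‖ * t ^ n ≤ ‖c j‖ * t ^ j} :=
      ⟨N, fun j hj ↦ by
        by_contra! hlt
        exact (hN j hlt.le).not_ge hj⟩
    have hmem := Nat.sSup_mem ⟨n, le_refl (‖c n‖ * t ^ n)⟩ hbdd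
    refine ⟨_, le_csSup hbdd (le_refl (‖c n‖ * t ^ n)), hmem, fun j hj ↦ ?_⟩
    by_contra! hle
    exact (le_csSup hbdd (hmem.trans hle)).not_gt hj
  have hd : d ≠ 0 := by omega
  have hcd : c d ≠ 0 := by
    intro h
    exact hpos.not_ge (by simpa [h] using hdn)
  let S (k : ℕ) : Set K :=
    {x | ‖x‖ ≤ t ∧ ‖∑' n, c n * x ^ n‖ ≤ ‖c d‖ * t ^ d * ((1 / 2 : ℝ) ^ k) ^ d}
  have hstep (k : ℕ) (x : S k) : ∃ y : S (k + 1), ‖(y : K) - x‖ ≤ t * (1 / 2 : ℝ) ^ k := by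
    obtain ⟨y, hyx, hy⟩ := exists_norm_sub_le_norm_tsum_le ht hc hd hcd hdmax x.2.1
      (e := (1 / 2 : ℝ) ^ k) (e' := (1 / 2 : ℝ) ^ (k + 1)) (by positivity)
      (pow_le_pow_of_le_one (by norm_num) (by norm_num) k.le_succ) x.2.2
    have hyt : ‖y‖ ≤ t := by
      have h1 := IsUltrametricDist.norm_add_le_max (y - x) (x : K)
      rw [sub_add_cancel] at h1
      refine h1.trans (max_le (hyx.trans ?_) x.2.1)
      exact mul_le_of_le_one_right ht.le (pow_le_one₀ (by norm_num) (by norm_num))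
    exact ⟨⟨y, hyt, hy hyt⟩, hyx⟩
  choose g hg using hstep
  let u : ∀ k, S k := fun k ↦ Nat.rec (motive := fun k ↦ S k)
    ⟨0, by simpa using ht.le, by rw [hF0]; simpa using h0.trans hdn⟩ (fun k x ↦ g k x) k
  have hu (k : ℕ) : dist (u k).1 (u (k + 1)).1 ≤ t * (1 / 2 : ℝ) ^ k := by
    rw [dist_comm, dist_eq_norm]
    exact hg k (u k)
  obtain ⟨x, hx⟩ := cauchySeq_tendsto_of_complete
    (cauchySeq_of_le_geometric (1 / 2 : ℝ) t (by norm_num) hu)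
  have hxt : ‖x‖ ≤ t := le_of_tendsto hx.norm (Eventually.of_forall fun k ↦ (u k).2.1)
  refine ⟨x, hxt, ?_⟩
  obtain ⟨B, hB⟩ := exists_norm_tsum_sub_tsum_le ht hc
  have hlim1 : Tendsto (fun k ↦ ∑' n, c n * (u k).1 ^ n) atTop (𝓝 (∑' n, c n * x ^ n)) := by
    refine tendsto_iff_norm_sub_tendsto_zero.2
      (squeeze_zero (fun _ ↦ norm_nonneg _) (fun k ↦ hB _ _ (u k).2.1 hxt) ?_)
    simpa using (tendsto_iff_norm_sub_tendsto_zero.1 hx).const_mul B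
  have hlim2 : Tendsto (fun k ↦ ∑' n, c n * (u k).1 ^ n) atTop (𝓝 0) := by
    refine squeeze_zero_norm (fun k ↦ (u k).2.2) ?_
    have := ((tendsto_pow_atTop_nhds_zero_of_lt_one (r := (1 / 2 : ℝ)) (by norm_num)
      (by norm_num)).pow d).const_mul (‖c d‖ * t ^ d)
    simpa [hd] using this
  exact tendsto_nhds_unique hlim1 hlim2

theorem tsum_update_mul_pow (hc : Tendsto (fun n ↦ ‖c n‖ * t ^ n) atTop (𝓝 0)) {x : K}
    (hx : ‖x‖ ≤ t) (i : ℕ) (v : K) :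
    ∑' n, Function.update c i v n * x ^ n = ∑' n, c n * x ^ n - (c i - v) * x ^ i := by
  have h := (summable_mul_pow hc hx).hasSum.update i (v * x ^ i)
  have e : (fun n ↦ Function.update c i v n * x ^ n) =
      Function.update (fun n ↦ c n * x ^ n) i (v * x ^ i) := by
    funext n
    rcases eq_or_ne n i with rfl | hn <;> simp [*]
  rw [e, h.tsum_eq]
  ring

/-- A convergent power series takes on the closed disk of radius `t` every value `q` whose
distance to the constant term is at most the size of some other term. -/
theorem exists_tsum_eq [IsAlgClosed K] (ht : 0 < t)
    (hc : Tendsto (fun n ↦ ‖c n‖ * t ^ n) atTop (𝓝 0)) {n : ℕ} (hn : n ≠ 0) {q : K}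
    (h0 : ‖c 0 - q‖ ≤ ‖c n‖ * t ^ n) : ∃ x : K, ‖x‖ ≤ t ∧ ∑' k, c k * x ^ k = q := by
  obtain ⟨x, hx, hx0⟩ := exists_tsum_eq_zero (c := Function.update c 0 (c 0 - q)) ht
    (tendsto_update_mul_pow hc 0 _) hn (by simpa [hn] using h0)
  rw [tsum_update_mul_pow hc hx] at hx0
  exact ⟨x, hx, by simpa [sub_eq_zero] using hx0⟩

/-- The mean value inequality for power series on a closed disk. -/
theorem norm_tsum_sub_tsum_le {ρ : ℝ} (hρ : ∀ k : ℕ, k ≠ 0 → ρ ^ (k - 1) ≤ ‖(k : K)‖)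
    (hρ0 : 0 < ρ) (hc : Tendsto (fun n ↦ ‖c n‖ * t ^ n) atTop (𝓝 0)) {x y : K} (hx : ‖x‖ ≤ t)
    (hy : ‖y‖ ≤ t) (hxy : ‖x - y‖ ≤ ρ * t) {B : ℝ}
    (hB : ∀ n : ℕ, ‖((n + 1 : ℕ) : K) * c (n + 1)‖ * t ^ n ≤ B) :
    ‖(∑' n, c n * x ^ n) - ∑' n, c n * y ^ n‖ ≤ B * ‖x - y‖ := by
  have ht : 0 ≤ t := (norm_nonneg y).trans hy
  have hB0 : 0 ≤ B := le_trans (by positivity) (hB 0)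
  rw [← (summable_mul_pow hc hx).tsum_sub (summable_mul_pow hc hy)]
  refine IsUltrametricDist.norm_tsum_le_of_forall_le_of_nonneg (by positivity) fun n ↦ ?_
  rcases n with _ | n
  · simp only [pow_zero, sub_self, norm_zero]
    positivity
  have h := norm_add_pow_sub_pow_le hρ hρ0 hy hxy n
  rw [sub_add_cancel] at h
  rw [← mul_sub, norm_mul]
  calc ‖c (n + 1)‖ * ‖x ^ (n + 1) - y ^ (n + 1)‖
      ≤ ‖c (n + 1)‖ * (‖((n + 1 : ℕ) : K)‖ * t ^ n * ‖x - y‖) := by gcongr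
    _ = ‖((n + 1 : ℕ) : K) * c (n + 1)‖ * t ^ n * ‖x - y‖ := by rw [norm_mul]; ring
    _ ≤ B * ‖x - y‖ := by gcongr; exact hB n

end PowerSeries

end Ultrametric

/-- **Non-Archimedean Mean Value Theorem.** For a power series `f(z) = ∑ a_n (z-a)^n`
convergent on `{|z - a| < r}` and points `z, w` of the disk with `|z - w| < ϱ·r`,
there is `u` in the disk with `|f(z) - f(w)| = |f'(u)| · |z - w|`. -/
theorem nonarchimedean_mean_value
    (p : ℕ) [Fact p.Prime] (K : Type*) [NontriviallyNormedField K] [Algebra ℚ_[p] K]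
    (hK : IsCp p K) (a : K) (r : ℝ) (hr : 0 < r) (aseq : ℕ → K)
    (hconv : ∀ z : K, ‖z - a‖ < r → Summable (fun n : ℕ => aseq n * (z - a) ^ n)) :
    ∀ z w : K, ‖z - a‖ < r → ‖w - a‖ < r → ‖z - w‖ < rho p * r →
      ∃ u : K, ‖u - a‖ < r ∧
        ‖(∑' n : ℕ, aseq n * (z - a) ^ n) - ∑' n : ℕ, aseq n * (w - a) ^ n‖ =
          ‖∑' n : ℕ, ((n + 1 : ℕ) : K) * aseq (n + 1) * (u - a) ^ n‖ * ‖z - w‖ := by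
  intro z w hz hw hzw
  have := hK.complete
  have := hK.isAlgClosed
  have : IsUltrametricDist K :=
    IsUltrametricDist.isUltrametricDist_of_forall_norm_add_le_max_norm hK.isNonarch
  have hρ0 := rho_pos p
  have hρ (k : ℕ) (hk : k ≠ 0) : rho p ^ (k - 1) ≤ ‖(k : K)‖ := by
    rw [← map_natCast (algebraMap ℚ_[p] K) k, hK.norm_extends]
    exact rho_pow_le_norm_natCast p hk
  rcases eq_or_ne z w with rfl | hne
  · exact ⟨a, by simpa using hr, by simp⟩
  have hh : 0 < ‖z - w‖ := norm_pos_iff.2 (sub_ne_zero.2 hne)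
  have hconv' (s : ℝ) (hs : 0 < s) (hsr : s < r) :
      Tendsto (fun n ↦ ‖aseq n‖ * s ^ n) atTop (𝓝 0) := by
    obtain ⟨x, hx1, hx2⟩ := exists_norm_mem_Ioo (K := K) hs hsr
    have h := (hconv (a + x) (by simpa using hx2)).tendsto_atTop_zero.norm
    simp only [add_sub_cancel_left, norm_zero, norm_mul, norm_pow] at h
    exact squeeze_zero (fun n ↦ by positivity) (fun n ↦ by gcongr) h
  set c : ℕ → K := fun n ↦ ((n + 1 : ℕ) : K) * aseq (n + 1) with hc_def
  have hc (s : ℝ) (hs : 0 < s) (hsr : s < r) : Tendsto (fun n ↦ ‖c n‖ * s ^ n) atTop (𝓝 0) := by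
    have h := ((tendsto_add_atTop_iff_nat 1).2 (hconv' s hs hsr)).div_const s
    rw [zero_div] at h
    refine squeeze_zero (fun n ↦ by positivity) (fun n ↦ ?_) h
    rw [le_div_iff₀ hs, mul_assoc, ← pow_succ, hc_def, norm_mul]
    gcongr
    exact mul_le_of_le_one_left (norm_nonneg _) (IsUltrametricDist.norm_natCast_le_one K _)
  obtain ⟨t₀, hzt, hwt, hht, ht₀r⟩ : ∃ t₀, ‖z - a‖ ≤ t₀ ∧ ‖w - a‖ ≤ t₀ ∧
      ‖z - w‖ / rho p ≤ t₀ ∧ t₀ < r :=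
    ⟨max ‖z - a‖ (max ‖w - a‖ (‖z - w‖ / rho p)), by simp, by simp, by simp,
      max_lt hz (max_lt hw ((div_lt_iff₀' hρ0).2 hzw))⟩
  have ht₀ : 0 < t₀ := (div_pos hh hρ0).trans_le hht
  rw [div_le_iff₀' hρ0] at hht
  have hsub : (z - a) - (w - a) = z - w := by ring
  rw [← hsub] at hht hh ⊢
  by_cases hdom : ∃ t n, t₀ ≤ t ∧ t < r ∧ n ≠ 0 ∧ ‖c 0‖ ≤ ‖c n‖ * t ^ n
  · obtain ⟨t, n, ht₀t, htr, hn, h0⟩ := hdom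
    have ht : 0 < t := ht₀.trans_le ht₀t
    obtain ⟨m, hm0, hm⟩ : ∃ m, m ≠ 0 ∧ ∀ k, ‖c k‖ * t ^ k ≤ ‖c m‖ * t ^ m := by
      obtain ⟨m, hm⟩ := exists_forall_le_of_tendsto_zero (fun k ↦ by positivity) (hc t ht htr)
      rcases eq_or_ne m 0 with rfl | hm0
      · exact ⟨n, hn, fun k ↦ (hm k).trans (by simpa using h0)⟩
      · exact ⟨m, hm0, hm⟩
    have hle := norm_tsum_sub_tsum_le hρ hρ0 (hconv' t ht htr) (hzt.trans ht₀t) (hwt.trans ht₀t)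
      (hht.trans (by gcongr)) hm
    obtain ⟨x, hx, hxq⟩ := exists_tsum_eq ht (hc t ht htr) hm0
      (q := ((∑' n, aseq n * (z - a) ^ n) - ∑' n, aseq n * (w - a) ^ n) / ((z - a) - (w - a)))
      ((norm_sub_le_max_norm _ _).trans
        (max_le (by simpa using hm 0) (by rwa [norm_div, div_le_iff₀ hh])))
    refine ⟨a + x, by simpa using hx.trans_lt htr, ?_⟩
    rw [add_sub_cancel_left, hxq, norm_div, div_mul_cancel₀ _ hh.ne']
  · push Not at hdom
    have hlt (n : ℕ) (hn : n ≠ 0) := hdom t₀ n le_rfl ht₀r hn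
    have hc0 : 0 < ‖c 0‖ := lt_of_le_of_lt (by positivity) (hlt 1 one_ne_zero)
    have hA := hconv' t₀ ht₀ ht₀r
    obtain ⟨m, hm⟩ := exists_forall_le_of_tendsto_zero (fun k ↦ by positivity)
      (tendsto_update_mul_pow (hc t₀ ht₀ ht₀r) 0 0)
    have hmlt : ‖Function.update c 0 0 m‖ * t₀ ^ m < ‖c 0‖ := by
      rcases eq_or_ne m 0 with rfl | hm0
      · simpa using hc0
      · simpa [hm0] using hlt m hm0
    have hle := norm_tsum_sub_tsum_le hρ hρ0 (tendsto_update_mul_pow hA 1 0) hzt hwt hht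
      (B := ‖Function.update c 0 0 m‖ * t₀ ^ m) fun n ↦ by
        refine le_trans (le_of_eq ?_) (hm n)
        rcases eq_or_ne n 0 with rfl | hn <;> simp [*]
    rw [tsum_update_mul_pow hA hzt, tsum_update_mul_pow hA hwt] at hle
    refine ⟨a, by simpa using hr, ?_⟩
    have hderiv : ∑' n, c n * (a - a) ^ n = c 0 := by
      rw [tsum_eq_single 0 fun k hk ↦ by simp [hk]]
      simp
    rw [hderiv, ← norm_mul]
    rw [← norm_neg (c 0 * _)]
    refine IsUltrametricDist.norm_eq_of_add_norm_lt_max (lt_max_of_lt_right ?_)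
    rw [norm_neg, norm_mul]
    refine lt_of_le_of_lt (le_of_eq_of_le ?_ hle) (mul_lt_mul_of_pos_right hmlt hh)
    congr 1
    simp only [hc_def]
    push_cast
    ring
end
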